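/- Let B ⊆ A be linear subspaces of ℝ^d with dim B = b ≥ 1 and dim A = a, b ≤ a ≤ d and b < d. Let ψ, φ : [1,∞) → (0,∞) be decreasing functions with ψ(T) ≤ 1 for all T, and suppose dist(z, B) ≥ ψ(|z|) for every nonzero z ∈ ℤ^d. Then there is a constant κ > 0 depending only on d such that for every integer T ≥ 1, the number of z ∈ ℤ^d with 1 ≤ |z| ≤ T and dist(z, A) ≤ φ(|z|) is at most κ·M_T, where M_T = Σ_{j=0}^{⌊log₂ T⌋} μ_{T/2^j} and μ_S = (S/ψ(S))^{a−b} · max{1, (φ(S)/ψ(S))^{d−a}} for S ≥ 1 (μ_S = 0 for 0 ≤ S < 1). -/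

import Mathlib

open MeasureTheory Filter

noncomputable section

/-- The sup-norm of a vector in Euclidean space. -/
def supNorm {d : ℕ} (w : EuclideanSpace ℝ (Fin d)) : ℝ := ⨆ i, |w i|

/-- The point of `ℝ^d` (with Euclidean metric) corresponding to an integer vector. -/
def intVec {d : ℕ} (z : Fin d → ℤ) : EuclideanSpace ℝ (Fin d) :=
  (WithLp.equiv 2 (Fin d → ℝ)).symm (fun i => (z i : ℝ))

/-- The irrationality measure function `ψ_B` of a linear subspace of `ℝ^d`:
`ψ_B(t) = inf { dist(z, B) : z ∈ ℤ^d, 1 ≤ |z| < t }`. -/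
def psiSub {d : ℕ} (B : Submodule ℝ (EuclideanSpace ℝ (Fin d))) (t : ℝ) : ℝ :=
  sInf ((fun z : Fin d → ℤ =>
      Metric.infDist (intVec z) (B : Set (EuclideanSpace ℝ (Fin d)))) ''
    {z | 1 ≤ supNorm (intVec z) ∧ supNorm (intVec z) < t})

/-- The Diophantine exponent of a linear subspace of `ℝ^d`:
`ω(B) = sup { γ : liminf_{t→∞} t^γ ψ_B(t) < ∞ }`, as an extended real number. -/
def diophExp {d : ℕ} (B : Submodule ℝ (EuclideanSpace ℝ (Fin d))) : EReal :=
  sSup {x : EReal | ∃ γ : ℝ, x = (γ : EReal) ∧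
    Filter.liminf (fun t : ℝ => ENNReal.ofReal (t ^ γ * psiSub B t)) Filter.atTop < ⊤}

/-- The graph subspace `C(Θ)` of an `(a-c)×c` matrix `Θ`, relative to an orthonormal
basis `e` of an `a`-dimensional subspace of `ℝ^d`:
`C(Θ) = { ∑ x_j e_j + ∑_i (∑_j θ_{ij} x_j) e_{c+i} : x ∈ ℝ^c }`. -/
def graphSub (d a c : ℕ) (hca : c ≤ a) (e : Fin a → EuclideanSpace ℝ (Fin d))
    (Θ : Fin (a - c) → Fin c → ℝ) : Submodule ℝ (EuclideanSpace ℝ (Fin d)) :=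
  Submodule.span ℝ {v | ∃ x : Fin c → ℝ,
    v = (∑ j : Fin c, x j • e (Fin.castLE hca j)) +
        ∑ i : Fin (a - c), (∑ j : Fin c, Θ i j * x j) • e ⟨c + i.1, by have := i.2; omega⟩}

/-- `μ_T = (T/ψ(T))^{a−b} · max{1, (φ(T)/ψ(T))^{d−a}}` for `T ≥ 1`, and `μ_T = 0` for `T < 1`. -/
def muF (a b d : ℕ) (ψ φ : ℝ → ℝ) (T : ℝ) : ℝ :=
  if T < 1 then 0 else (T / ψ T) ^ (a - b) * max 1 ((φ T / ψ T) ^ (d - a))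

/-- `M_T = Σ_{j=0}^{⌊log₂ T⌋} μ_{T/2^j}` for integers `T ≥ 1` (and `M_0 = 0`). -/
def MF (a b d : ℕ) (ψ φ : ℝ → ℝ) (T : ℕ) : ℝ :=
  ∑ j ∈ Finset.range (Nat.log 2 T + 1), muF a b d ψ φ ((T : ℝ) / 2 ^ j)

/-- `λ_T = M_T − M_{T−1}` for integers `T ≥ 1`. -/
def lamF (a b d : ℕ) (ψ φ : ℝ → ℝ) (T : ℕ) : ℝ :=
  MF a b d ψ φ T - MF a b d ψ φ (T - 1)

theorem intVec_apply {d : ℕ} (z : Fin d → ℤ) (i : Fin d) : intVec z i = (z i : ℝ) := rfl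

theorem intVec_sub {d : ℕ} (z w : Fin d → ℤ) : intVec (z - w) = intVec z - intVec w := by
  ext i
  simp [intVec_apply]

theorem abs_apply_le_supNorm {d : ℕ} (w : EuclideanSpace ℝ (Fin d)) (i : Fin d) :
    |w i| ≤ supNorm w :=
  le_ciSup (f := fun i => |w i|) (Set.finite_range _).bddAbove i

theorem supNorm_le {d : ℕ} {w : EuclideanSpace ℝ (Fin d)} {c : ℝ} (hc : 0 ≤ c)
    (h : ∀ i, |w i| ≤ c) : supNorm w ≤ c :=
  Real.iSup_le h hc

theorem one_le_supNorm_intVec {d : ℕ} {z : Fin d → ℤ} (hz : z ≠ 0) :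
    1 ≤ supNorm (intVec z) := by
  obtain ⟨i, hi⟩ := Function.ne_iff.1 hz
  refine le_trans ?_ (abs_apply_le_supNorm _ i)
  have h : 1 ≤ |z i| := Int.one_le_abs hi
  rw [intVec_apply, ← Int.cast_abs]
  exact_mod_cast h

theorem norm_le_mul_supNorm {d : ℕ} (w : EuclideanSpace ℝ (Fin d)) :
    ‖w‖ ≤ d * supNorm w := by
  rcases Nat.eq_zero_or_pos d with rfl | hd
  · simp [EuclideanSpace.norm_eq]
  have h0 : 0 ≤ supNorm w := (abs_nonneg _).trans (abs_apply_le_supNorm w ⟨0, hd⟩)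
  refine le_of_sq_le_sq ?_ (by positivity)
  rw [EuclideanSpace.norm_sq_eq]
  calc ∑ i, ‖w i‖ ^ 2 ≤ ∑ _i : Fin d, supNorm w ^ 2 := by
        gcongr with i
        exact abs_apply_le_supNorm w i
    _ = d * supNorm w ^ 2 := by simp
    _ ≤ (d * supNorm w) ^ 2 := by
        rw [mul_pow]
        gcongr
        exact_mod_cast Nat.le_self_pow two_ne_zero d

theorem norm_le_sum_abs_inner {E ι : Type*} [NormedAddCommGroup E] [InnerProductSpace ℝ E]
    [Fintype ι] {K : Submodule ℝ E} (g : OrthonormalBasis ι ℝ K) {u : E} (hu : u ∈ K) :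
    ‖u‖ ≤ ∑ i, |inner ℝ (g i : E) u| :=
  calc ‖u‖ = ‖∑ i, inner ℝ (g i) (⟨u, hu⟩ : K) • g i‖ := by rw [g.sum_repr' ⟨u, hu⟩]; rfl
    _ ≤ ∑ i, ‖inner ℝ (g i) (⟨u, hu⟩ : K) • g i‖ := norm_sum_le _ _
    _ = _ := by simp [norm_smul]

/-- If every coordinate of `v` along orthonormal bases of `Bᗮ ⊓ A` and of `Aᗮ` is smaller than
`δ`, then `v` is close to `B`. -/
theorem infDist_lt_of_inner_lt {E : Type*} [NormedAddCommGroup E] [InnerProductSpace ℝ E]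
    [FiniteDimensional ℝ E] {B A : Submodule ℝ E} (hBA : B ≤ A) {ι κ : Type*} [Fintype ι]
    [Fintype κ] [Nonempty (ι ⊕ κ)] (e : OrthonormalBasis ι ℝ ↥(Bᗮ ⊓ A))
    (f : OrthonormalBasis κ ℝ Aᗮ) {v : E} {δ : ℝ}
    (he : ∀ i, |inner ℝ (e i : E) v| < δ) (hf : ∀ k, |inner ℝ (f k : E) v| < δ) :
    Metric.infDist v (B : Set E) < (Fintype.card ι + Fintype.card κ : ℕ) * δ := by
  obtain ⟨p, hp, w, hw, rfl⟩ := A.exists_add_mem_mem_orthogonal v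
  have hp' := hp
  rw [← Submodule.sup_orthogonal_inf_of_hasOrthogonalProjection hBA] at hp'
  obtain ⟨x, hx, y, hy, rfl⟩ := Submodule.mem_sup.1 hp'
  have h1 : ∀ i, inner ℝ (e i : E) (x + y + w) = inner ℝ (e i : E) y := by
    intro i
    have hi := (e i).2
    rw [inner_add_right, inner_add_right, Submodule.inner_left_of_mem_orthogonal hx hi.1,
      Submodule.inner_right_of_mem_orthogonal hi.2 hw]
    ring
  have h2 : ∀ k, inner ℝ (f k : E) (x + y + w) = inner ℝ (f k : E) w := by
    intro k
    rw [inner_add_right, Submodule.inner_left_of_mem_orthogonal hp (f k).2]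
    ring
  calc Metric.infDist (x + y + w) (B : Set E) ≤ dist (x + y + w) x :=
        Metric.infDist_le_dist_of_mem hx
    _ = ‖y + w‖ := by rw [dist_eq_norm]; congr 1; abel
    _ ≤ ‖y‖ + ‖w‖ := norm_add_le _ _
    _ ≤ ∑ i, |inner ℝ (e i : E) y| + ∑ k, |inner ℝ (f k : E) w| :=
        add_le_add (norm_le_sum_abs_inner e hy) (norm_le_sum_abs_inner f hw)
    _ = ∑ s : ι ⊕ κ, Sum.elim (fun i => |inner ℝ (e i : E) (x + y + w)|)
          (fun k => |inner ℝ (f k : E) (x + y + w)|) s := by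
        simp [Fintype.sum_sum_type, h1, h2]
    _ < ∑ _s : ι ⊕ κ, δ := by
        refine Finset.sum_lt_sum_of_nonempty Finset.univ_nonempty ?_
        rintro (i | k) -
        · exact he i
        · exact hf k
    _ = _ := by simp

theorem abs_inner_le_infDist_of_mem_orthogonal {E : Type*} [NormedAddCommGroup E]
    [InnerProductSpace ℝ E] {A : Submodule ℝ E} {u : E} (hu : u ∈ Aᗮ) (hu1 : ‖u‖ = 1) (v : E) :
    |inner ℝ u v| ≤ Metric.infDist v (A : Set E) := by
  refine (Metric.le_infDist ⟨0, A.zero_mem⟩).2 fun p hp => ?_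
  have : inner ℝ u v = inner ℝ u (v - p) := by
    rw [inner_sub_right, Submodule.inner_left_of_mem_orthogonal hp hu, sub_zero]
  rw [this, dist_eq_norm]
  simpa [hu1] using abs_real_inner_le_norm u (v - p)

/-- The range of values of `⌊x⌋` for `|x| ≤ R`. -/
def floorRange (R : ℝ) : Finset ℤ := Finset.Icc ⌊-R⌋ ⌊R⌋

theorem floor_mem_floorRange {x R : ℝ} (h : |x| ≤ R) : ⌊x⌋ ∈ floorRange R :=
  Finset.mem_Icc.2 ⟨Int.floor_mono (abs_le.1 h).1, Int.floor_mono (abs_le.1 h).2⟩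

theorem card_floorRange_le {R : ℝ} (hR : 0 ≤ R) : ((floorRange R).card : ℝ) ≤ 2 * R + 2 := by
  have h : ⌊-R⌋ ≤ ⌊R⌋ := Int.floor_mono (by linarith)
  have h1 : (((floorRange R).card : ℤ) : ℝ) = ⌊R⌋ + 1 - ⌊-R⌋ := by
    rw [floorRange, Int.card_Icc, Int.toNat_of_nonneg (by omega)]
    push_cast
    ring
  have := Int.floor_le R
  have := Int.lt_floor_add_one (-R)
  push_cast at h1
  linarith

/-- The number of integer points in a dyadic shell lying close to `A`. -/
theorem shell_bound {d a b : ℕ} {B A : Submodule ℝ (EuclideanSpace ℝ (Fin d))} {ψ φ : ℝ → ℝ}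
    (hba : b ≤ a) (had : a ≤ d) (hbd : b < d) (hBA : B ≤ A)
    (hB : Module.finrank ℝ B = b) (hA : Module.finrank ℝ A = a)
    (hψ0 : ∀ T : ℝ, 1 ≤ T → 0 < ψ T) (hφ0 : ∀ T : ℝ, 1 ≤ T → 0 < φ T)
    (hψ : AntitoneOn ψ (Set.Ici 1)) (hφ : AntitoneOn φ (Set.Ici 1))
    (hψ1 : ∀ T : ℝ, 1 ≤ T → ψ T ≤ 1)
    (hbad : ∀ z : Fin d → ℤ, z ≠ 0 → ψ (supNorm (intVec z)) ≤
      Metric.infDist (intVec z) (B : Set (EuclideanSpace ℝ (Fin d))))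
    {S : ℝ} (hS : 1 ≤ S) :
    {z : Fin d → ℤ | S ≤ supNorm (intVec z) ∧ supNorm (intVec z) ≤ 2 * S ∧
      Metric.infDist (intVec z) (A : Set (EuclideanSpace ℝ (Fin d))) ≤
        φ (supNorm (intVec z))}.Finite ∧
    ({z : Fin d → ℤ | S ≤ supNorm (intVec z) ∧ supNorm (intVec z) ≤ 2 * S ∧
      Metric.infDist (intVec z) (A : Set (EuclideanSpace ℝ (Fin d))) ≤
        φ (supNorm (intVec z))}.ncard : ℝ) ≤
      (6 * (4 * d ^ 2 + 2)) ^ d * muF a b d ψ φ S := by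
  set X := {z : Fin d → ℤ | S ≤ supNorm (intVec z) ∧ supNorm (intVec z) ≤ 2 * S ∧
      Metric.infDist (intVec z) (A : Set (EuclideanSpace ℝ (Fin d))) ≤
        φ (supNorm (intVec z))} with hX
  have hS0 : 0 < S := by linarith
  have hd : (0 : ℝ) < d := by exact_mod_cast (Nat.zero_le b).trans_lt hbd
  have hd1 : (1 : ℝ) ≤ d := by exact_mod_cast (Nat.zero_le b).trans_lt hbd
  have hψS := hψ0 S hS
  have hφS := hφ0 S hS
  have hC : Module.finrank ℝ ↥(Bᗮ ⊓ A) = a - b := by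
    have := Submodule.finrank_add_inf_finrank_orthogonal hBA
    omega
  have hD : Module.finrank ℝ Aᗮ = d - a := by
    have := A.finrank_add_finrank_orthogonal
    rw [finrank_euclideanSpace_fin] at this
    omega
  let e : OrthonormalBasis (Fin (a - b)) ℝ ↥(Bᗮ ⊓ A) :=
    (stdOrthonormalBasis ℝ ↥(Bᗮ ⊓ A)).reindex (finCongr hC)
  let f : OrthonormalBasis (Fin (d - a)) ℝ Aᗮ :=
    (stdOrthonormalBasis ℝ Aᗮ).reindex (finCongr hD)
  have hne : Nonempty (Fin (a - b) ⊕ Fin (d - a)) := by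
    rw [← Fintype.card_pos_iff]
    simp
    omega
  have he1 : ∀ i, ‖(e i : EuclideanSpace ℝ (Fin d))‖ = 1 := fun i => e.orthonormal.1 i
  have hf1 : ∀ i, ‖(f i : EuclideanSpace ℝ (Fin d))‖ = 1 := fun i => f.orthonormal.1 i
  let F : (Fin d → ℤ) → (Fin d → ℤ) × (Fin (a - b) → ℤ) × (Fin (d - a) → ℤ) := fun z =>
    (fun i => ⌊(z i : ℝ) / S⌋,
      fun i => ⌊inner ℝ (e i : EuclideanSpace ℝ (Fin d)) (intVec z) / (ψ S / d)⌋,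
      fun k => ⌊inner ℝ (f k : EuclideanSpace ℝ (Fin d)) (intVec z) / (ψ S / d)⌋)
  let Y : Finset ((Fin d → ℤ) × (Fin (a - b) → ℤ) × (Fin (d - a) → ℤ)) :=
    Fintype.piFinset (fun _ => floorRange 2) ×ˢ
      Fintype.piFinset (fun _ => floorRange (d * (2 * S) / (ψ S / d))) ×ˢ
      Fintype.piFinset (fun _ => floorRange (φ S / (ψ S / d)))
  have hmaps : Set.MapsTo F X Y := by
    rintro z ⟨h1, h2, h3⟩
    simp only [Y, F, Finset.coe_product, Set.mem_prod, Finset.mem_coe, Fintype.mem_piFinset]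
    refine ⟨fun i => floor_mem_floorRange ?_, fun i => floor_mem_floorRange ?_,
      fun k => floor_mem_floorRange ?_⟩
    · rw [abs_div, abs_of_pos hS0, div_le_iff₀ hS0, ← intVec_apply]
      exact (abs_apply_le_supNorm _ i).trans h2
    · rw [abs_div, abs_of_pos (div_pos hψS hd)]
      gcongr
      calc |inner ℝ (e i : EuclideanSpace ℝ (Fin d)) (intVec z)| ≤ ‖intVec z‖ := by
            simpa [he1] using abs_real_inner_le_norm (e i : EuclideanSpace ℝ (Fin d)) (intVec z)
        _ ≤ d * supNorm (intVec z) := norm_le_mul_supNorm _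
        _ ≤ _ := by gcongr
    · rw [abs_div, abs_of_pos (div_pos hψS hd)]
      gcongr
      exact ((abs_inner_le_infDist_of_mem_orthogonal (f k).2 (hf1 k) _).trans h3).trans
        (hφ hS (hS.trans h1) h1)
  have hinj : Set.InjOn F X := by
    rintro z - w - hzw
    simp only [F, Prod.mk.injEq, funext_iff] at hzw
    obtain ⟨h1, h2, h3⟩ := hzw
    by_contra hne'
    have hsub : z - w ≠ 0 := sub_ne_zero.2 hne'
    have hle : supNorm (intVec (z - w)) ≤ S := by
      refine supNorm_le hS0.le fun i => ?_
      have := Int.abs_sub_lt_one_of_floor_eq_floor (h1 i)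
      rw [← sub_div, abs_div, abs_of_pos hS0, div_lt_one hS0] at this
      simpa [intVec_apply] using this.le
    have hlow : ψ S ≤ Metric.infDist (intVec (z - w)) (B : Set (EuclideanSpace ℝ (Fin d))) :=
      (hψ (one_le_supNorm_intVec hsub) hS hle).trans (hbad _ hsub)
    have hδ : 0 < ψ S / d := div_pos hψS hd
    have hclose : ∀ u : EuclideanSpace ℝ (Fin d),
        ⌊inner ℝ u (intVec z) / (ψ S / d)⌋ = ⌊inner ℝ u (intVec w) / (ψ S / d)⌋ →
        |inner ℝ u (intVec (z - w))| < ψ S / d := by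
      intro u hu
      have := Int.abs_sub_lt_one_of_floor_eq_floor hu
      rwa [← sub_div, abs_div, abs_of_pos hδ, div_lt_one hδ, ← inner_sub_right,
        ← intVec_sub] at this
    have hup := infDist_lt_of_inner_lt hBA e f (fun i => hclose _ (h2 i))
      (fun k => hclose _ (h3 k))
    have hcard : ((Fintype.card (Fin (a - b)) + Fintype.card (Fin (d - a)) : ℕ) : ℝ) *
        (ψ S / d) ≤ d * (ψ S / d) := by
      gcongr
      simp
      omega
    rw [mul_div_cancel₀ _ hd.ne'] at hcard
    linarith
  refine ⟨Set.Finite.of_injOn hmaps hinj Y.finite_toSet, ?_⟩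
  have hcard : X.ncard ≤ Y.card := by
    rw [← Set.ncard_coe_finset]
    exact Set.ncard_le_ncard_of_injOn F hmaps hinj Y.finite_toSet
  have hSψ : 1 ≤ S / ψ S := by
    rw [one_le_div hψS]
    exact (hψ1 S hS).trans hS
  have hK1 : (1 : ℝ) ≤ 4 * d ^ 2 + 2 := by nlinarith
  calc (X.ncard : ℝ) ≤ Y.card := by exact_mod_cast hcard
    _ = ((floorRange 2).card : ℝ) ^ d *
        (((floorRange (d * (2 * S) / (ψ S / d))).card : ℝ) ^ (a - b) *
        ((floorRange (φ S / (ψ S / d))).card : ℝ) ^ (d - a)) := by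
        simp [Y]
    _ ≤ 6 ^ d * (((4 * d ^ 2 + 2) * (S / ψ S)) ^ (a - b) *
        ((4 * d ^ 2 + 2) * max 1 (φ S / ψ S)) ^ (d - a)) := by
        gcongr
        · exact (card_floorRange_le zero_le_two).trans (by norm_num)
        · refine (card_floorRange_le (by positivity)).trans ?_
          have : d * (2 * S) / (ψ S / d) = 2 * d ^ 2 * (S / ψ S) := by field_simp
          rw [this]
          linarith
        · refine (card_floorRange_le (by positivity)).trans ?_
          have : φ S / (ψ S / d) = d * (φ S / ψ S) := by field_simp
          rw [this]
          have h1 : d * (φ S / ψ S) ≤ d * max 1 (φ S / ψ S) := by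
            gcongr
            exact le_max_right _ _
          have h2 : 1 ≤ max 1 (φ S / ψ S) := le_max_left _ _
          have h3 : d * max 1 (φ S / ψ S) ≤ d ^ 2 * max 1 (φ S / ψ S) := by
            gcongr
            nlinarith
          nlinarith [sq_nonneg (d : ℝ)]
    _ = 6 ^ d * (4 * d ^ 2 + 2) ^ (a - b + (d - a)) *
        ((S / ψ S) ^ (a - b) * max 1 (φ S / ψ S) ^ (d - a)) := by
        rw [mul_pow, mul_pow, pow_add]
        ring
    _ ≤ 6 ^ d * (4 * d ^ 2 + 2) ^ d *
        ((S / ψ S) ^ (a - b) * max 1 (φ S / ψ S) ^ (d - a)) := by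
        gcongr
        omega
    _ ≤ 6 ^ d * (4 * d ^ 2 + 2) ^ d *
        ((S / ψ S) ^ (a - b) * max 1 ((φ S / ψ S) ^ (d - a))) := by
        gcongr
        rcases le_total 1 (φ S / ψ S) with h | h
        · rw [max_eq_right h]
          exact le_max_right _ _
        · rw [max_eq_left h, one_pow]
          exact le_max_left _ _
    _ = _ := by
        rw [muF, if_neg (not_lt.2 hS), mul_pow]

theorem one_le_muF {a b d : ℕ} {ψ φ : ℝ → ℝ} {S : ℝ} (hS : 1 ≤ S) (h0 : 0 < ψ S)
    (h1 : ψ S ≤ 1) : 1 ≤ muF a b d ψ φ S := by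
  rw [muF, if_neg (not_lt.2 hS)]
  refine one_le_mul_of_one_le_of_one_le (one_le_pow₀ ?_) (le_max_left _ _)
  rw [one_le_div h0]
  exact h1.trans hS

/-- There are few integer points of sup-norm smaller than `2`. -/
theorem small_bound (d : ℕ) :
    {z : Fin d → ℤ | supNorm (intVec z) < 2}.Finite ∧
      {z : Fin d → ℤ | supNorm (intVec z) < 2}.ncard ≤ 3 ^ d := by
  have hsub : {z : Fin d → ℤ | supNorm (intVec z) < 2} ⊆
      (Fintype.piFinset fun _ : Fin d => Finset.Icc (-1 : ℤ) 1 : Finset (Fin d → ℤ)) := by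
    intro z hz
    simp only [Finset.mem_coe, Fintype.mem_piFinset, Finset.mem_Icc]
    intro i
    have h : |(z i : ℝ)| < 2 := (abs_apply_le_supNorm (intVec z) i).trans_lt hz
    have h' : |z i| < 2 := by exact_mod_cast h
    rw [abs_lt] at h'
    omega
  refine ⟨(Finset.finite_toSet _).subset hsub, ?_⟩
  refine (Set.ncard_le_ncard hsub (Finset.finite_toSet _)).trans ?_
  rw [Set.ncard_coe_finset]
  simp

/-- there is `κ > 0` depending only on `d` such that for subspaces `B ⊆ A` of
`ℝ^d` with `dim B = b ≥ 1`, `dim A = a`, `b ≤ a ≤ d`, `b < d`, decreasing positive `ψ, φ` with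
`ψ ≤ 1` and `B` being `ψ`-badly approximable, and every integer `T ≥ 1`, the number of
`z ∈ ℤ^d` with `1 ≤ |z| ≤ T` and `dist(z,A) ≤ φ(|z|)` is at most `κ·M_T`. -/
theorem stmt_12 (d : ℕ) :
    ∃ κ : ℝ, 0 < κ ∧
      ∀ (a b : ℕ) (B A : Submodule ℝ (EuclideanSpace ℝ (Fin d))) (ψ φ : ℝ → ℝ),
        1 ≤ b → b ≤ a → a ≤ d → b < d → B ≤ A →
        Module.finrank ℝ B = b → Module.finrank ℝ A = a →
        (∀ T : ℝ, 1 ≤ T → 0 < ψ T) → (∀ T : ℝ, 1 ≤ T → 0 < φ T) →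
        AntitoneOn ψ (Set.Ici 1) → AntitoneOn φ (Set.Ici 1) →
        (∀ T : ℝ, 1 ≤ T → ψ T ≤ 1) →
        (∀ z : Fin d → ℤ, z ≠ 0 →
          ψ (supNorm (intVec z)) ≤
            Metric.infDist (intVec z) (B : Set (EuclideanSpace ℝ (Fin d)))) →
        ∀ T : ℕ, 1 ≤ T →
          {z : Fin d → ℤ | 1 ≤ supNorm (intVec z) ∧ supNorm (intVec z) ≤ (T : ℝ) ∧
              Metric.infDist (intVec z) (A : Set (EuclideanSpace ℝ (Fin d))) ≤
                φ (supNorm (intVec z))}.Finite ∧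
          (({z : Fin d → ℤ | 1 ≤ supNorm (intVec z) ∧ supNorm (intVec z) ≤ (T : ℝ) ∧
              Metric.infDist (intVec z) (A : Set (EuclideanSpace ℝ (Fin d))) ≤
                φ (supNorm (intVec z))}.ncard : ℝ)) ≤ κ * MF a b d ψ φ T := by
  refine ⟨(6 * (4 * d ^ 2 + 2)) ^ d + 3 ^ d, by positivity, ?_⟩
  intro a b B A ψ φ _ hba had hbd hBA hB hA hψ0 hφ0 hψ hφ hψ1 hbad T hT
  have hT0 : T ≠ 0 := by omega
  set L := Nat.log 2 T
  have hS : ∀ j ∈ Finset.range (L + 1), (1 : ℝ) ≤ T / 2 ^ j := by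
    intro j hj
    rw [one_le_div (by positivity)]
    exact_mod_cast Nat.pow_le_of_le_log hT0 (Nat.lt_succ_iff.1 (Finset.mem_range.1 hj))
  have hlt : (T : ℝ) / 2 ^ L < 2 := by
    rw [div_lt_iff₀ (by positivity), ← pow_succ']
    exact_mod_cast Nat.lt_pow_succ_log_self one_lt_two T
  set X := {z : Fin d → ℤ | 1 ≤ supNorm (intVec z) ∧ supNorm (intVec z) ≤ (T : ℝ) ∧
    Metric.infDist (intVec z) (A : Set (EuclideanSpace ℝ (Fin d))) ≤ φ (supNorm (intVec z))}
  let shell : ℕ → Set (Fin d → ℤ) := fun j =>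
    {z | (T : ℝ) / 2 ^ j ≤ supNorm (intVec z) ∧ supNorm (intVec z) ≤ 2 * ((T : ℝ) / 2 ^ j) ∧
      Metric.infDist (intVec z) (A : Set (EuclideanSpace ℝ (Fin d))) ≤ φ (supNorm (intVec z))}
  have hshell : ∀ j ∈ Finset.range (L + 1), (shell j).Finite ∧ ((shell j).ncard : ℝ) ≤
      (6 * (4 * d ^ 2 + 2)) ^ d * muF a b d ψ φ ((T : ℝ) / 2 ^ j) := fun j hj =>
    shell_bound hba had hbd hBA hB hA hψ0 hφ0 hψ hφ hψ1 hbad (hS j hj)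
  have hsub : X ⊆ (⋃ j ∈ Finset.range (L + 1), shell j) ∪
      {z : Fin d → ℤ | supNorm (intVec z) < 2} := by
    rintro z ⟨h1, h2, h3⟩
    by_cases hz : supNorm (intVec z) < 2
    · exact Or.inr hz
    left
    have hex : ∃ j, (T : ℝ) / 2 ^ j ≤ supNorm (intVec z) := ⟨L, by linarith⟩
    classical
    have hmin := Nat.find_spec hex
    have hjL : Nat.find hex ≤ L := Nat.find_le (by linarith)
    refine Set.mem_biUnion (x := Nat.find hex) (by simpa using Nat.lt_succ_iff.2 hjL)
      ⟨hmin, ?_, h3⟩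
    rcases hj : Nat.find hex with _ | j
    · simp only [pow_zero, div_one]
      have : (0 : ℝ) ≤ T := by positivity
      linarith
    · have := not_le.1 (Nat.find_min hex (m := j) (by omega))
      refine this.le.trans (le_of_eq ?_)
      field_simp
      ring
  have hfin1 : (⋃ j ∈ Finset.range (L + 1), shell j).Finite :=
    Set.Finite.biUnion (Finset.finite_toSet _) fun j hj => (hshell j hj).1
  obtain ⟨hfin2, hsmall⟩ := small_bound d
  refine ⟨(hfin1.union hfin2).subset hsub, ?_⟩
  have hone : ∀ j ∈ Finset.range (L + 1), 1 ≤ muF a b d ψ φ ((T : ℝ) / 2 ^ j) := fun j hj =>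
    one_le_muF (hS j hj) (hψ0 _ (hS j hj)) (hψ1 _ (hS j hj))
  have hM : 1 ≤ MF a b d ψ φ T := by
    have h0 : 0 ∈ Finset.range (L + 1) := by simp
    exact (hone 0 h0).trans (Finset.single_le_sum
      (f := fun j => muF a b d ψ φ ((T : ℝ) / 2 ^ j))
      (fun j hj => zero_le_one.trans (hone j hj)) h0)
  have hnat : X.ncard ≤ ∑ j ∈ Finset.range (L + 1), (shell j).ncard + 3 ^ d :=
    calc X.ncard ≤ _ := Set.ncard_le_ncard hsub (hfin1.union hfin2)
      _ ≤ _ := Set.ncard_union_le _ _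
      _ ≤ _ := add_le_add (Finset.set_ncard_biUnion_le _ _) hsmall
  calc (X.ncard : ℝ) ≤ ∑ j ∈ Finset.range (L + 1), ((shell j).ncard : ℝ) + 3 ^ d := by
        exact_mod_cast hnat
    _ ≤ ∑ j ∈ Finset.range (L + 1),
          (6 * (4 * d ^ 2 + 2)) ^ d * muF a b d ψ φ ((T : ℝ) / 2 ^ j) +
          3 ^ d * MF a b d ψ φ T := by
        gcongr with j hj
        · exact (hshell j hj).2
        · exact le_mul_of_one_le_right (by positivity) hM
    _ = _ := by
        rw [← Finset.mul_sum, add_mul]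
        rfl

end
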